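/- Let z ∈ ℂ∖{0} and let α, β, F, G, H : ℤ → ℂ satisfy the stationary zero-curvature relations at z, with F(n) ≠ 0 and γ(n) := 1 − α(n)β(n) ≠ 0 for all n. Let w ∈ ℂ satisfy w² = G(n)² − F(n)H(n) for all n, define φ(n) := (w + G(n))/F(n) and φ*(n) := (−w + G(n))/F(n). Fix n₀ ∈ ℤ; define ψ₁ as the product Π_{n'=n₀+1}^{n}(z + α(n')φ(n'−1)) for n ≥ n₀+1, ψ₁(n₀) = 1, and the reciprocal product for n ≤ n₀−1; define ψ₁* analogously with φ replaced by φ*; set ψ₂ := φψ₁ and ψ₂* := φ*ψ₁*; and define Γ(n,n₀) := Π_{n'=n₀+1}^{n} γ(n') for n ≥ n₀+1, Γ(n₀,n₀) := 1, Γ(n,n₀) := Π_{n'=n+1}^{n₀} γ(n')^{−1} for n ≤ n₀−1. Then for all n ∈ ℤ: ψ₁(n)ψ₁*(n) = z^{n−n₀}·(F(n)/F(n₀))·Γ(n,n₀); ψ₂(n)ψ₂*(n) = z^{n−n₀}·(H(n)/F(n₀))·Γ(n,n₀); ψ₁(n)ψ₂*(n) + ψ₁*(n)ψ₂(n) = 2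 z^{n−n₀}·(G(n)/F(n₀))·Γ(n,n₀); ψ₁(n)ψ₂*(n) − ψ₁*(n)ψ₂(n) = −2w·z^{n−n₀}·Γ(n,n₀)/F(n₀). -/

import Mathlib

/-- The meromorphic function `φ(n) = (w + G(n))/F(n)`. -/
noncomputable def phiP (F G : ℤ → ℂ) (w : ℂ) (n : ℤ) : ℂ := (w + G n) / F n

/-- The function on the other sheet, `φ*(n) = (−w + G(n))/F(n)`. -/
noncomputable def phiM (F G : ℤ → ℂ) (w : ℂ) (n : ℤ) : ℂ := (-w + G n) / F n

/-- `prodZ f n₀ n = Π_{n'=n₀+1}^{n} f(n')` for `n ≥ n₀`, `= 1` for `n = n₀`, and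
`= (Π_{n'=n+1}^{n₀} f(n'))⁻¹` for `n ≤ n₀ − 1`. -/
noncomputable def prodZ (f : ℤ → ℂ) (n₀ n : ℤ) : ℂ :=
  if n₀ ≤ n then ∏ k ∈ Finset.Icc (n₀ + 1) n, f k
  else (∏ k ∈ Finset.Icc (n + 1) n₀, f k)⁻¹

/-- The first component of the Baker–Akhiezer vector built from `φ`. -/
noncomputable def psi1 (α F G : ℤ → ℂ) (w z : ℂ) (n₀ n : ℤ) : ℂ :=
  prodZ (fun n' => z + α n' * phiP F G w (n' - 1)) n₀ n

/-- The first component of the Baker–Akhiezer vector built from `φ*`. -/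
noncomputable def psi1s (α F G : ℤ → ℂ) (w z : ℂ) (n₀ n : ℤ) : ℂ :=
  prodZ (fun n' => z + α n' * phiM F G w (n' - 1)) n₀ n

lemma prodZ_self (f : ℤ → ℂ) (n₀ : ℤ) : prodZ f n₀ n₀ = 1 := by
  simp [prodZ]

lemma prodZ_succ (f : ℤ → ℂ) (hf : ∀ n, f n ≠ 0) (n₀ n : ℤ) :
    prodZ f n₀ (n + 1) = prodZ f n₀ n * f (n + 1) := by
  unfold prodZ
  by_cases h : n₀ ≤ n
  · rw [if_pos h, if_pos (by omega)]
    have : Finset.Icc (n₀ + 1) (n + 1) = insert (n + 1) (Finset.Icc (n₀ + 1) n) := by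
      ext x; simp only [Finset.mem_Icc, Finset.mem_insert]; omega
    rw [this, Finset.prod_insert (by simp), mul_comm]
  · rw [if_neg h]
    have : Finset.Icc (n + 1) n₀ = insert (n + 1) (Finset.Icc (n + 1 + 1) n₀) := by
      ext x; simp only [Finset.mem_Icc, Finset.mem_insert]; omega
    rw [this, Finset.prod_insert (by simp)]
    by_cases h' : n₀ ≤ n + 1
    · have e : n₀ = n + 1 := by omega
      subst e
      simp [hf]
    · rw [if_neg h', mul_inv, mul_comm (f (n + 1))⁻¹, mul_assoc, inv_mul_cancel₀ (hf _), mul_one]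

/-- Quadratic identities for the Baker–Akhiezer vector:
`ψ₁ψ₁* = z^{n−n₀} (F(n)/F(n₀)) Γ`, `ψ₂ψ₂* = z^{n−n₀} (H(n)/F(n₀)) Γ`,
`ψ₁ψ₂* + ψ₁*ψ₂ = 2 z^{n−n₀} (G(n)/F(n₀)) Γ`, and
`ψ₁ψ₂* − ψ₁*ψ₂ = −2w z^{n−n₀} Γ / F(n₀)`, where `ψ₂ = φψ₁`, `ψ₂* = φ*ψ₁*`,
and `Γ = Γ(n,n₀)` is the product of `γ = 1 − αβ`. -/
theorem baker_akhiezer_quadratic_identities (z : ℂ) (hz : z ≠ 0)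
    (α β F G H : ℤ → ℂ)
    (h1 : ∀ n : ℤ, z * (G (n - 1) - G n) + z * β n * F n + α n * H (n - 1) = 0)
    (h2 : ∀ n : ℤ, z * β n * F (n - 1) + α n * H n - G n + G (n - 1) = 0)
    (h3 : ∀ n : ℤ, -F n + z * F (n - 1) + α n * (G n + G (n - 1)) = 0)
    (h4 : ∀ n : ℤ, z * β n * (G n + G (n - 1)) - z * H n + H (n - 1) = 0)
    (hF : ∀ n : ℤ, F n ≠ 0)
    (hγ : ∀ n : ℤ, 1 - α n * β n ≠ 0)
    (w : ℂ) (hw : ∀ n : ℤ, w ^ 2 = G n ^ 2 - F n * H n)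
    (n₀ : ℤ) :
    ∀ n : ℤ,
      psi1 α F G w z n₀ n * psi1s α F G w z n₀ n
          = z ^ (n - n₀) * (F n / F n₀) * prodZ (fun n' => 1 - α n' * β n') n₀ n
      ∧ (phiP F G w n * psi1 α F G w z n₀ n) * (phiM F G w n * psi1s α F G w z n₀ n)
          = z ^ (n - n₀) * (H n / F n₀) * prodZ (fun n' => 1 - α n' * β n') n₀ n
      ∧ psi1 α F G w z n₀ n * (phiM F G w n * psi1s α F G w z n₀ n)
            + psi1s α F G w z n₀ n * (phiP F G w n * psi1 α F G w z n₀ n)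
          = 2 * z ^ (n - n₀) * (G n / F n₀) * prodZ (fun n' => 1 - α n' * β n') n₀ n
      ∧ psi1 α F G w z n₀ n * (phiM F G w n * psi1s α F G w z n₀ n)
            - psi1s α F G w z n₀ n * (phiP F G w n * psi1 α F G w z n₀ n)
          = -2 * w * z ^ (n - n₀) * prodZ (fun n' => 1 - α n' * β n') n₀ n / F n₀ := by
  have key : ∀ n : ℤ, (z + α n * phiP F G w (n - 1)) * (z + α n * phiM F G w (n - 1))
      = z * (F n / F (n - 1)) * (1 - α n * β n) := by
    intro n
    have hF' := hF (n - 1)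
    unfold phiP phiM
    field_simp
    have a1 := h1 n
    have a3 := h3 n
    have aw := hw (n - 1)
    linear_combination (-α n ^ 2) * aw + F (n - 1) * z * a3 + F (n - 1) * α n * a1
  have kne : ∀ n : ℤ, (z + α n * phiP F G w (n - 1)) * (z + α n * phiM F G w (n - 1)) ≠ 0 := by
    intro n
    rw [key]
    exact mul_ne_zero (mul_ne_zero hz (div_ne_zero (hF _) (hF _))) (hγ n)
  have hP := fun n => left_ne_zero_of_mul (kne n)
  have hM := fun n => right_ne_zero_of_mul (kne n)
  have step : ∀ n : ℤ, psi1 α F G w z n₀ (n + 1) * psi1s α F G w z n₀ (n + 1)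
      = psi1 α F G w z n₀ n * psi1s α F G w z n₀ n *
        (z * (F (n + 1) / F n) * (1 - α (n + 1) * β (n + 1))) := by
    intro n
    have k := key (n + 1)
    unfold psi1 psi1s
    rw [prodZ_succ _ hP, prodZ_succ _ hM]
    rw [add_sub_cancel_right] at k
    simp only [add_sub_cancel_right]
    rw [← k]
    ring
  have main : ∀ n : ℤ, psi1 α F G w z n₀ n * psi1s α F G w z n₀ n
      = z ^ (n - n₀) * (F n / F n₀) * prodZ (fun n' => 1 - α n' * β n') n₀ n := by
    have up : ∀ n : ℤ, z ^ (n + 1 - n₀) * (F (n + 1) / F n₀)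
          * prodZ (fun n' => 1 - α n' * β n') n₀ (n + 1)
        = z ^ (n - n₀) * (F n / F n₀) * prodZ (fun n' => 1 - α n' * β n') n₀ n *
          (z * (F (n + 1) / F n) * (1 - α (n + 1) * β (n + 1))) := by
      intro n
      rw [prodZ_succ _ hγ, show n + 1 - n₀ = (n - n₀) + 1 by ring, zpow_add_one₀ hz]
      have := hF n
      have := hF n₀
      field_simp
    intro n
    induction n using Int.inductionOn' (b := n₀) with
    | zero => simp [psi1, psi1s, prodZ_self, hF]
    | succ k _ ih => rw [step, up, ih]
    | pred k _ ih =>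
      have s := step (k - 1)
      have u := up (k - 1)
      simp only [sub_add_cancel] at s u
      rw [s, u] at ih
      exact mul_right_cancel₀
        (mul_ne_zero (mul_ne_zero hz (div_ne_zero (hF _) (hF _))) (hγ k)) ih
  intro n
  have m := main n
  have hFn := hF n
  have hF0 := hF n₀
  have aw := hw n
  have p1 : phiP F G w n * phiM F G w n = H n / F n := by
    unfold phiP phiM
    field_simp
    linear_combination -aw
  have p2 : phiM F G w n + phiP F G w n = 2 * G n / F n := by
    unfold phiP phiM
    field_simp
    ring
  have p3 : phiM F G w n - phiP F G w n = -2 * w / F n := by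
    unfold phiP phiM
    field_simp
    ring
  refine ⟨m, ?_, ?_, ?_⟩
  · rw [mul_mul_mul_comm, p1, m]
    field_simp
  · have : ∀ a b c d : ℂ, a * (c * b) + b * (d * a) = (a * b) * (c + d) := by intros; ring
    rw [this, p2, m]
    field_simp
  · have : ∀ a b c d : ℂ, a * (c * b) - b * (d * a) = (a * b) * (c - d) := by intros; ring
    rw [this, p3, m]
    field_simp
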